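/- arXiv:1307.4860 — 4 statements merged into one kernel-verified Lean document; each statement's English description precedes it below -/
import Mathlib

section
/- For every positive integer n, all positive real numbers a_1, ..., a_n, and every nonnegative integer r, the sum over all n-tuples (i_1, ..., i_n) of nonnegative integers with i_1 + ... + i_n = r of the multinomial coefficient r!/(i_1! ⋯ i_n!) times the product Γ(a_1 + i_1)/Γ(a_1) ⋯ Γ(a_n + i_n)/Γ(a_n) equals Γ(a_1 + ⋯ + a_n + r)/Γ(a_1 + ⋯ + a_n). -/
open Finset

/-- The rising factorial of a positive real as a ratio of Gamma values. -/
theorem Real.Gamma_add_natCast_div_Gamma {x : ℝ} (hx : 0 < x) (k : ℕ) :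
    Real.Gamma (x + k) / Real.Gamma x = (ascPochhammer ℝ k).eval x := by
  induction k with
  | zero => simp [(Real.Gamma_pos_of_pos hx).ne']
  | succ k ih =>
    rw [ascPochhammer_succ_eval, ← ih, Nat.cast_succ, ← add_assoc,
      Real.Gamma_add_one (by positivity)]
    ring

theorem succ_mul_ascPochhammer_eval_div_factorial {K : Type*} [Field K] [CharZero K]
    (x : K) (k : ℕ) :
    ((k + 1 : ℕ) : K) * ((ascPochhammer K (k + 1)).eval x / ((k + 1).factorial : K)) =
      (x + k) * ((ascPochhammer K k).eval x / (k.factorial : K)) := by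
  have h : ((k + 1 : ℕ) : K) ≠ 0 := Nat.cast_ne_zero.mpr k.succ_ne_zero
  have h' : (k.factorial : K) ≠ 0 := Nat.cast_ne_zero.mpr k.factorial_ne_zero
  rw [ascPochhammer_succ_eval, Nat.factorial_succ, Nat.cast_mul]
  field_simp

/-- The **Chu-Vandermonde identity** for rising factorials. -/
theorem sum_antidiagonal_ascPochhammer_eval_div_factorial {K : Type*} [Field K] [CharZero K]
    (x y : K) (k : ℕ) :
    ∑ p ∈ antidiagonal k, (ascPochhammer K p.1).eval x / (p.1.factorial : K) *
        ((ascPochhammer K p.2).eval y / (p.2.factorial : K)) =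
      (ascPochhammer K k).eval (x + y) / (k.factorial : K) := by
  induction k with
  | zero => simp
  | succ k ih =>
    apply mul_left_cancel₀ (Nat.cast_ne_zero.mpr k.succ_ne_zero : ((k + 1 : ℕ) : K) ≠ 0)
    rw [succ_mul_ascPochhammer_eval_div_factorial, ← ih, mul_sum, mul_sum]
    set c := fun (z : K) (i : ℕ) => (ascPochhammer K i).eval z / (i.factorial : K) with hc
    have hs : ∀ z i, ((i + 1 : ℕ) : K) * c z (i + 1) = (z + i) * c z i :=
      succ_mul_ascPochhammer_eval_div_factorial
    change ∑ p ∈ antidiagonal (k + 1), ((k + 1 : ℕ) : K) * (c x p.1 * c y p.2) =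
      ∑ p ∈ antidiagonal k, (x + y + k) * (c x p.1 * c y p.2)
    calc
      _ = ∑ p ∈ antidiagonal (k + 1), (p.1 : K) * c x p.1 * c y p.2 +
          ∑ p ∈ antidiagonal (k + 1), c x p.1 * ((p.2 : K) * c y p.2) := by
        rw [← sum_add_distrib]
        refine sum_congr rfl fun p hp => ?_
        rw [← mem_antidiagonal.mp hp, Nat.cast_add]
        ring
      _ = ∑ p ∈ antidiagonal k, (x + p.1) * c x p.1 * c y p.2 +
          ∑ p ∈ antidiagonal k, c x p.1 * ((y + p.2) * c y p.2) := by
        rw [Nat.sum_antidiagonal_succ, Nat.sum_antidiagonal_succ']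
        simp only [hs, Nat.cast_zero, zero_mul, mul_zero, zero_add]
      _ = _ := by
        rw [← sum_add_distrib]
        refine sum_congr rfl fun p hp => ?_
        rw [← mem_antidiagonal.mp hp, Nat.cast_add]
        ring

/-- The multivariate **Chu-Vandermonde identity** for rising factorials. -/
theorem sum_antidiagonalTuple_prod_ascPochhammer_eval_div_factorial {K : Type*} [Field K]
    [CharZero K] (n : ℕ) (a : Fin n → K) (r : ℕ) :
    ∑ i ∈ Nat.antidiagonalTuple n r,
        ∏ j, (ascPochhammer K (i j)).eval (a j) / ((i j).factorial : K) =
      (ascPochhammer K r).eval (∑ j, a j) / (r.factorial : K) := by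
  induction n generalizing r with
  | zero => cases r <;> simp
  | succ n ih =>
    rw [Fin.sum_univ_succ, ← sum_antidiagonal_ascPochhammer_eval_div_factorial]
    simp_rw [← ih, mul_sum]
    rw [sum_sigma']
    refine (sum_bij' (fun i _ => ⟨(i 0, ∑ j, Fin.tail i j), Fin.tail i⟩)
      (fun p _ => Fin.cons p.1.1 p.2) ?_ ?_ ?_ ?_ ?_)
    · intro i hi
      rw [Nat.mem_antidiagonalTuple, Fin.sum_univ_succ] at hi
      simpa [Nat.mem_antidiagonalTuple, Fin.tail] using hi
    · rintro ⟨⟨s, t⟩, p⟩ hp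
      simp only [mem_sigma, HasAntidiagonal.mem_antidiagonal, Nat.mem_antidiagonalTuple] at hp
      simp [Nat.mem_antidiagonalTuple, Fin.sum_univ_succ, hp.1, hp.2]
    · intro i _
      simp
    · rintro ⟨⟨s, t⟩, p⟩ hp
      simp only [mem_sigma, HasAntidiagonal.mem_antidiagonal, Nat.mem_antidiagonalTuple] at hp
      simp [hp.2]
    · intro i _
      rw [Fin.prod_univ_succ]
      rfl

/-- Lemma 2.1: for all positive integers `n`, positive reals `a_1, ..., a_n`, and
nonnegative integers `r`, the multinomial sum of products of Gamma ratios equals the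
Gamma ratio of the sum. -/
theorem gamma_multinomial_sum (n : ℕ) (hn : 0 < n) (a : Fin n → ℝ) (ha : ∀ j, 0 < a j)
    (r : ℕ) :
    ∑ i ∈ Finset.Nat.antidiagonalTuple n r,
      ((r.factorial : ℝ) / ∏ j, ((i j).factorial : ℝ)) *
        ∏ j, Real.Gamma (a j + i j) / Real.Gamma (a j)
      = Real.Gamma ((∑ j, a j) + r) / Real.Gamma (∑ j, a j) := by
  have hsum : 0 < ∑ j, a j := sum_pos (fun j _ => ha j) ⟨⟨0, hn⟩, mem_univ _⟩
  have hr : (r.factorial : ℝ) ≠ 0 := Nat.cast_ne_zero.mpr r.factorial_ne_zero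
  rw [Real.Gamma_add_natCast_div_Gamma hsum, ← mul_div_cancel₀ (Polynomial.eval _ _) hr,
    ← sum_antidiagonalTuple_prod_ascPochhammer_eval_div_factorial, mul_sum]
  refine sum_congr rfl fun i _ => ?_
  simp_rw [Real.Gamma_add_natCast_div_Gamma (ha _), prod_div_distrib]
  ring
end

section
/- For every integer n ≥ 2 and every nonnegative integer k, the following Gamma identity holds: (2k)! · (n−1)! · Γ(n/2 + k) / (Γ(2k + n) · k! · Γ(n/2)) = Γ(n/2 + 1/2) · Γ(k + 1/2) / (√π · Γ(k + n/2 + 1/2)). -/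
/-- The Gamma identity from the proof of Theorem 2.2: for integers `n ≥ 2` and `k ≥ 0`,
`(2k)! (n-1)! Γ(n/2 + k) / (Γ(2k + n) k! Γ(n/2))
  = Γ(n/2 + 1/2) Γ(k + 1/2) / (√π Γ(k + n/2 + 1/2))`. -/
theorem gamma_identity (n : ℕ) (hn : 2 ≤ n) (k : ℕ) :
    ((2 * k).factorial : ℝ) * ((n - 1).factorial : ℝ) * Real.Gamma ((n : ℝ) / 2 + k) /
        (Real.Gamma (2 * (k : ℝ) + n) * (k.factorial : ℝ) * Real.Gamma ((n : ℝ) / 2))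
      = Real.Gamma ((n : ℝ) / 2 + 1 / 2) * Real.Gamma ((k : ℝ) + 1 / 2) /
          (Real.sqrt Real.pi * Real.Gamma ((k : ℝ) + (n : ℝ) / 2 + 1 / 2)) := by
  have hn' : (0 : ℝ) < n := by exact_mod_cast (by omega : 0 < n)
  have hN : Real.Gamma (n : ℝ) = ((n - 1).factorial : ℝ) := by
    rw [← Real.Gamma_nat_eq_factorial, ← Nat.cast_succ, Nat.succ_eq_add_one,
      Nat.sub_add_cancel (by omega)]
  have h₁ := Real.Gamma_mul_Gamma_add_half ((n : ℝ) / 2)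
  have h₂ := Real.Gamma_mul_Gamma_add_half ((n : ℝ) / 2 + k)
  have h₃ := Real.Gamma_mul_Gamma_add_half ((k : ℝ) + 1 / 2)
  rw [show 2 * ((n : ℝ) / 2) = n by ring, hN] at h₁
  rw [show 2 * ((n : ℝ) / 2 + k) = 2 * (k : ℝ) + n by ring,
    show 1 - (2 * (k : ℝ) + n) = (1 - n) + (-(2 * k)) by ring,
    Real.rpow_add two_pos, show (n : ℝ) / 2 + k + 1 / 2 = k + n / 2 + 1 / 2 by ring] at h₂
  rw [show (k : ℝ) + 1 / 2 + 1 / 2 = k + 1 by ring, Real.Gamma_nat_eq_factorial,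
    show 2 * ((k : ℝ) + 1 / 2) = ((2 * k : ℕ) : ℝ) + 1 by push_cast; ring,
    Real.Gamma_nat_eq_factorial,
    show 1 - (((2 * k : ℕ) : ℝ) + 1) = -(2 * k) by push_cast; ring] at h₃
  have hG : Real.Gamma (2 * (k : ℝ) + n) ≠ 0 := (Real.Gamma_pos_of_pos (by positivity)).ne'
  have ha : Real.Gamma ((n : ℝ) / 2) ≠ 0 := (Real.Gamma_pos_of_pos (by positivity)).ne'
  have hd : Real.Gamma ((k : ℝ) + (n : ℝ) / 2 + 1 / 2) ≠ 0 :=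
    (Real.Gamma_pos_of_pos (by positivity)).ne'
  have hk : (k.factorial : ℝ) ≠ 0 := by positivity
  have hpi : Real.sqrt Real.pi ≠ 0 := by positivity
  rw [div_eq_div_iff (by simp only [ne_eq, mul_eq_zero, not_or]; exact ⟨⟨hG, hk⟩, ha⟩)
    (mul_ne_zero hpi hd)]
  set r := Real.sqrt Real.pi
  set G := Real.Gamma (2 * (k : ℝ) + n)
  linear_combination ((2 * k).factorial : ℝ) * ((n - 1).factorial : ℝ) * r * h₂
    - Real.Gamma ((k : ℝ) + 1 / 2) * (k.factorial : ℝ) * G * h₁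
    - ((n - 1).factorial : ℝ) * (2 : ℝ) ^ (1 - (n : ℝ)) * r * G * h₃
end

section
/- Let n ≥ 2, let Δ = {(r_1, ..., r_{n-1}) ∈ ℝ^{n-1} : r_j ≥ 0, r_1 + ⋯ + r_{n-1} ≤ 1} with r_n := 1 − (r_1 + ⋯ + r_{n-1}). Then for every nonnegative integer k, the iterated integral over Δ (with weight (n−1)!) and over (x_1, ..., x_n) ∈ (−1, 1)^n (with weight ∏_{j=1}^{n} 1/(π √(1 − x_j²))) of (r_1 x_1 + ⋯ + r_n x_n)^{2k} equals Γ(k + 1/2) · Γ(n/2 + 1/2) / (√π · Γ(k + n/2 + 1/2)); that is, the 2k-th moment of the randomly weighted average S_n of n i.i.d. Arcsin(−1,1) random variables with Dirichlet(1,...,1) weights equals the 2k-th moment of the power semicircle distribution with parameter λ = (n−1)/2. -/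
open MeasureTheory

theorem integral_pow_mul_sub_pow (s : ℝ) (a b : ℕ) :
    ∫ t in (0 : ℝ)..s, t ^ a * (s - t) ^ b
      = (a.factorial * b.factorial / (a + b + 1).factorial : ℝ) * s ^ (a + b + 1) := by
  induction a generalizing b with
  | zero =>
    have := intervalIntegral.integral_comp_sub_left (a := 0) (b := s) (fun t : ℝ => t ^ b) s
    simp only [pow_zero, one_mul, this, sub_self, sub_zero, integral_pow, zero_add]
    rw [Nat.factorial_succ b]
    have := Nat.factorial_ne_zero b
    push_cast
    field_simp
    simp
  | succ a ih =>
    have hd : ∀ t ∈ Set.uIcc 0 s, HasDerivAt (fun t : ℝ => t ^ (a + 1) * (s - t) ^ (b + 1))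
        ((a + 1) * (t ^ a * (s - t) ^ (b + 1)) - (b + 1) * (t ^ (a + 1) * (s - t) ^ b)) t := by
      intro t _
      have h1 := hasDerivAt_pow (a + 1) t
      have h2 := ((hasDerivAt_id t).const_sub s).pow (b + 1)
      convert! h1.mul h2 using 1
      simp
      ring
    have key := intervalIntegral.integral_eq_sub_of_hasDerivAt hd
      (Continuous.intervalIntegrable (by fun_prop) _ _)
    rw [intervalIntegral.integral_sub (Continuous.intervalIntegrable (by fun_prop) _ _)
      (Continuous.intervalIntegrable (by fun_prop) _ _), intervalIntegral.integral_const_mul,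
      intervalIntegral.integral_const_mul, ih (b + 1)] at key
    simp only [sub_self, sub_zero, ne_eq, Nat.succ_ne_zero, not_false_eq_true, zero_pow, mul_zero,
      zero_mul] at key
    rw [show a + (b + 1) + 1 = a + 1 + b + 1 by ring] at key
    rw [← mul_right_inj' (show (b + 1 : ℝ) ≠ 0 by positivity), ← sub_eq_zero.mp key,
      Nat.factorial_succ a, Nat.factorial_succ b]
    push_cast
    ring

open Real in
theorem arcsin_moment_eq (a : ℕ) :
    ∫ x in Set.Ioo (-1 : ℝ) 1, 1 / (π * √(1 - x ^ 2)) * x ^ a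
      = (∫ θ in (0 : ℝ)..π, cos θ ^ a) / π := by
  rw [← Polynomial.Chebyshev.integral_measureT_eq_integral_cos (f := fun x => x ^ a),
    Polynomial.Chebyshev.integral_measureT, intervalIntegral.integral_of_le (by norm_num),
    integral_Ioc_eq_integral_Ioo, ← integral_div]
  congr 1 with x
  rw [Real.sqrt_inv]
  field_simp

open Real in
theorem integral_cos_pow_add_two (a : ℕ) :
    (a + 2) * ∫ θ in (0 : ℝ)..π, cos θ ^ (a + 2) = (a + 1) * ∫ θ in (0 : ℝ)..π, cos θ ^ a := by
  rw [integral_cos_pow]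
  simp
  field_simp

open Real in
theorem integrable_arcsin_mul_pow (a : ℕ) :
    IntegrableOn (fun x : ℝ => 1 / (π * √(1 - x ^ 2)) * x ^ a) (Set.Ioo (-1) 1) := by
  have := (Polynomial.Chebyshev.intervalIntegrable_sqrt_one_sub_sq_inv.continuousOn_mul
    (g := fun x : ℝ => x ^ a / π) (by fun_prop)).1
  rw [integrableOn_Ioc_iff_integrableOn_Ioo] at this
  refine this.congr_fun (fun x _ => ?_) measurableSet_Ioo
  simp only [Real.sqrt_inv]
  field_simp

/-- The solid simplex of size `s` is compact. -/
theorem isCompact_solid_simplex (m : ℕ) (s : ℝ) :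
    IsCompact {p : Fin m → ℝ | (∀ j, 0 ≤ p j) ∧ ∑ j, p j ≤ s} := by
  refine (isCompact_univ_pi fun _ : Fin m => isCompact_Icc (a := (0 : ℝ)) (b := s)).of_isClosed_subset
    ?_ ?_
  · simp only [Set.ofPred_and, Set.ofPred_forall]
    exact (isClosed_iInter fun j => isClosed_le (by fun_prop) (by fun_prop)).inter
      (isClosed_le (by fun_prop) (by fun_prop))
  · intro p hp j _
    exact ⟨hp.1 j, (Finset.single_le_sum (fun i _ => hp.1 i) (Finset.mem_univ j)).trans hp.2⟩

theorem coeff_mk_pow_eq_sum_piAntidiag (μ : ℕ → ℝ) (n d : ℕ) :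
    ∑ a ∈ Finset.piAntidiag (Finset.univ : Finset (Fin n)) d, ∏ j, μ (a j)
      = PowerSeries.coeff d (PowerSeries.mk μ ^ n) := by
  have := PowerSeries.coeff_prod (fun _ : Fin n => PowerSeries.mk μ) d Finset.univ
  rw [Finset.prod_const, Finset.card_univ, Fintype.card_fin] at this
  rw [this, Finset.finsuppAntidiag, Finset.sum_map, ← Finset.sum_attach]
  simp

/-- If `A = ∑ μ a X ^ a` solves `(1 - X ^ 2) * dA = X * A`, then the coefficients of `A ^ n` satisfy a
two-term recurrence, because `(1 - X ^ 2) * d(A ^ n) = n * X * A ^ n`. -/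
theorem coeff_mk_pow_add_two {μ : ℕ → ℝ} (h1 : μ 1 = 0)
    (h : ∀ a : ℕ, (a + 2) * μ (a + 2) = (a + 1) * μ a) (n d : ℕ) :
    (d + 2) * PowerSeries.coeff (d + 2) (PowerSeries.mk μ ^ n)
      = (n + d) * PowerSeries.coeff d (PowerSeries.mk μ ^ n) := by
  set A := PowerSeries.mk μ with hA
  have hode : PowerSeries.derivative ℝ A
      = PowerSeries.X * (PowerSeries.X * PowerSeries.derivative ℝ A) + PowerSeries.X * A := by
    ext m
    rcases m with _ | _ | m
    · simp [PowerSeries.coeff_derivative, hA, h1]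
    · have := h 0
      simp [PowerSeries.coeff_derivative, PowerSeries.coeff_succ_X_mul, hA] at this ⊢
      linarith
    · have := h (m + 1)
      simp [PowerSeries.coeff_derivative, PowerSeries.coeff_succ_X_mul, hA] at this ⊢
      linarith
  have hpow : PowerSeries.derivative ℝ (A ^ n)
      = PowerSeries.X * (PowerSeries.X * PowerSeries.derivative ℝ (A ^ n))
        + (n : PowerSeries ℝ) * (PowerSeries.X * A ^ n) := by
    rw [PowerSeries.derivative_pow]
    rcases n with _ | n
    · simp
    · rw [Nat.add_sub_cancel]
      push_cast
      linear_combination ((n : PowerSeries ℝ) + 1) * A ^ n * hode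
  generalize A ^ n = B at hpow ⊢
  have hc := congrArg (PowerSeries.coeff (d + 1)) hpow
  rw [map_add, ← nsmul_eq_mul, map_nsmul, nsmul_eq_mul] at hc
  rcases d with _ | d
  · simp [PowerSeries.coeff_derivative, PowerSeries.coeff_succ_X_mul] at hc ⊢
    linarith
  · simp [PowerSeries.coeff_derivative, PowerSeries.coeff_succ_X_mul] at hc ⊢
    linarith

theorem coeff_two_mul_mk_pow {μ : ℕ → ℝ} (h0 : μ 0 = 1) (h1 : μ 1 = 0)
    (h : ∀ a : ℕ, (a + 2) * μ (a + 2) = (a + 1) * μ a) (m k : ℕ) :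
    (m.factorial * (2 * k).factorial / (2 * k + m).factorial : ℝ)
        * PowerSeries.coeff (2 * k) (PowerSeries.mk μ ^ (m + 1))
      = Real.Gamma (k + 1 / 2) * Real.Gamma ((m + 1 : ℕ) / 2 + 1 / 2) /
          (√Real.pi * Real.Gamma (k + (m + 1 : ℕ) / 2 + 1 / 2)) := by
  induction k with
  | zero =>
    have hG : Real.Gamma ((m + 1 : ℕ) / 2 + 1 / 2) ≠ 0 := (Real.Gamma_pos_of_pos (by positivity)).ne'
    have := Nat.factorial_ne_zero m
    have hπ : √Real.pi ≠ 0 := by positivity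
    simp only [Nat.cast_zero, zero_add, mul_zero, Real.Gamma_one_half_eq]
    simp [h0]
    field_simp
  | succ k ih =>
    have hrec := coeff_mk_pow_add_two h1 h (m + 1) (2 * k)
    have hG : Real.Gamma (k + (m + 1 : ℕ) / 2 + 1 / 2) ≠ 0 :=
      (Real.Gamma_pos_of_pos (by positivity)).ne'
    have e1 : Real.Gamma ((k + 1 : ℕ) + 1 / 2) = (k + 1 / 2) * Real.Gamma (k + 1 / 2) := by
      rw [← Real.Gamma_add_one (by positivity)]; push_cast; ring_nf
    have e2 : Real.Gamma ((k + 1 : ℕ) + (m + 1 : ℕ) / 2 + 1 / 2)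
        = (k + (m + 1 : ℕ) / 2 + 1 / 2) * Real.Gamma (k + (m + 1 : ℕ) / 2 + 1 / 2) := by
      rw [← Real.Gamma_add_one (by positivity)]; push_cast; ring_nf
    have e3 : PowerSeries.coeff (2 * (k + 1)) (PowerSeries.mk μ ^ (m + 1))
        = (m + 1 + 2 * k) / (2 * k + 2)
          * PowerSeries.coeff (2 * k) (PowerSeries.mk μ ^ (m + 1)) := by
      rw [div_mul_eq_mul_div, eq_div_iff (by positivity), mul_comm]
      push_cast at hrec
      exact hrec
    have e4 : ((2 * (k + 1)).factorial : ℝ) = (2 * k + 2) * (2 * k + 1) * (2 * k).factorial := by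
      rw [show 2 * (k + 1) = 2 * k + 1 + 1 by ring, Nat.factorial_succ, Nat.factorial_succ]
      push_cast; ring
    have e5 : ((2 * (k + 1) + m).factorial : ℝ)
        = (2 * k + m + 2) * (2 * k + m + 1) * (2 * k + m).factorial := by
      rw [show 2 * (k + 1) + m = 2 * k + m + 1 + 1 by ring, Nat.factorial_succ, Nat.factorial_succ]
      push_cast; ring
    have e6 : (k + 1 / 2 : ℝ) / (k + (m + 1 : ℕ) / 2 + 1 / 2) = (2 * k + 1) / (2 * k + m + 2) := by
      rw [div_eq_div_iff (by positivity) (by positivity)]; push_cast; ring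
    rw [e1, e2, e3, e4, e5]
    calc _ = (2 * k + 1) / (2 * k + m + 2)
          * ((m.factorial * (2 * k).factorial / (2 * k + m).factorial : ℝ)
            * PowerSeries.coeff (2 * k) (PowerSeries.mk μ ^ (m + 1))) := by
          have := Nat.factorial_ne_zero (2 * k + m)
          field_simp
          ring
      _ = _ := by
          rw [ih, ← e6]
          field_simp

/-- The Dirichlet integral over the solid simplex, for natural exponents. -/
theorem integral_solid_simplex_prod_pow (m : ℕ) (a : Fin m → ℕ) (b : ℕ) {s : ℝ} (hs : 0 ≤ s) :
    ∫ p in {p : Fin m → ℝ | (∀ j, 0 ≤ p j) ∧ ∑ j, p j ≤ s},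
        (∏ j, p j ^ a j) * (s - ∑ j, p j) ^ b
      = ((∏ j, (a j).factorial) * b.factorial / (∑ j, a j + b + m).factorial : ℝ)
        * s ^ (∑ j, a j + b + m) := by
  induction m generalizing s with
  | zero =>
    have : (b.factorial : ℝ) ≠ 0 := by exact_mod_cast Nat.factorial_ne_zero b
    simp [hs, this, Measure.volume_pi_eq_dirac (0 : Fin 0 → ℝ)]
  | succ m ih =>
    set e := MeasurableEquiv.piFinSuccAbove (fun _ : Fin (m + 1) => ℝ) 0
    have he : MeasurePreserving e volume volume := volume_preserving_piFinSuccAbove _ 0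
    set N := ∑ j, a (Fin.succ j) + b + m with hN
    set S := {p : Fin (m + 1) → ℝ | (∀ j, 0 ≤ p j) ∧ ∑ j, p j ≤ s} with hS
    set f : (Fin (m + 1) → ℝ) → ℝ := fun p => (∏ j, p j ^ a j) * (s - ∑ j, p j) ^ b
    have hint : Integrable (S.indicator f) volume :=
      (integrable_indicator_iff (isCompact_solid_simplex _ _).measurableSet).mpr
        (ContinuousOn.integrableOn_compact (isCompact_solid_simplex _ _) (by fun_prop))
    have hsymm : MeasurePreserving e.symm volume volume := he.symm e
    have hval : ∀ t : ℝ, ∫ q, S.indicator f (e.symm (t, q)) =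
        (Set.Icc 0 s).indicator (fun t => t ^ a 0 *
          ((∏ j, (a (Fin.succ j)).factorial) * b.factorial / N.factorial * (s - t) ^ N)) t := by
      intro t
      by_cases ht : t ∈ Set.Icc 0 s
      · rw [Set.indicator_of_mem ht, hN, ← ih (fun j => a j.succ) (sub_nonneg.mpr ht.2),
          ← integral_const_mul,
          ← integral_indicator (isCompact_solid_simplex _ _).measurableSet]
        congr 1 with q
        have hmem : e.symm (t, q) ∈ S ↔
            q ∈ {q : Fin m → ℝ | (∀ j, 0 ≤ q j) ∧ ∑ j, q j ≤ s - t} := by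
          simp [hS, e, Fin.forall_fin_succ, Fin.sum_univ_succ, ht.1, le_sub_iff_add_le']
        simp only [Set.indicator, hmem]
        congr 1
        simp [f, e, Fin.prod_univ_succ, Fin.sum_univ_succ, sub_sub, mul_assoc]
      · rw [Set.indicator_of_notMem ht]
        refine integral_eq_zero_of_ae (.of_forall fun q => ?_)
        refine Set.indicator_of_notMem (fun hq => ht ?_) _
        have h0 : 0 ≤ t := by simpa [e] using hq.1 0
        refine ⟨h0, le_trans ?_ hq.2⟩
        have := Finset.single_le_sum (fun i _ => hq.1 i) (Finset.mem_univ 0)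
        simpa [e] using this
    rw [← integral_indicator (isCompact_solid_simplex _ _).measurableSet,
      ← hsymm.integral_comp', Measure.volume_eq_prod,
      integral_prod (fun z => S.indicator f (e.symm z))
        ((hsymm.integrable_comp_emb e.symm.measurableEmbedding).mpr hint)]
    simp_rw [hval]
    rw [integral_indicator measurableSet_Icc, integral_Icc_eq_integral_Ioc,
      ← intervalIntegral.integral_of_le hs]
    simp_rw [mul_left_comm (_ ^ a 0)]
    rw [intervalIntegral.integral_const_mul, integral_pow_mul_sub_pow, Fin.prod_univ_succ,
      Fin.sum_univ_succ, show a 0 + ∑ j : Fin m, a j.succ + b + (m + 1) = a 0 + N + 1 by omega]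
    have := Nat.factorial_ne_zero N
    push_cast
    field_simp

open Real in
theorem integral_arcsin_weighted_sum_pow {ι : Type*} [Fintype ι] [DecidableEq ι] (r : ι → ℝ)
    (d : ℕ) :
    ∫ x in Set.univ.pi fun _ : ι => Set.Ioo (-1 : ℝ) 1,
        (∏ j, 1 / (π * √(1 - x j ^ 2))) * (∑ j, r j * x j) ^ d
      = ∑ a ∈ Finset.piAntidiag Finset.univ d, (Nat.multinomial Finset.univ a : ℝ) *
          ((∏ j, r j ^ a j) * ∏ j, ∫ x in Set.Ioo (-1 : ℝ) 1, 1 / (π * √(1 - x ^ 2)) * x ^ a j) := by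
  have hexpand : ∀ x : ι → ℝ, (∏ j, 1 / (π * √(1 - x j ^ 2))) * (∑ j, r j * x j) ^ d
      = ∑ a ∈ Finset.piAntidiag Finset.univ d, ((Nat.multinomial Finset.univ a : ℝ) *
          ∏ j, r j ^ a j) * ∏ j, (1 / (π * √(1 - x j ^ 2)) * x j ^ a j) := by
    intro x
    rw [Finset.sum_pow_eq_sum_piAntidiag, Finset.mul_sum]
    refine Finset.sum_congr rfl fun a _ => ?_
    simp only [mul_pow, Finset.prod_mul_distrib]
    ring
  simp_rw [hexpand]
  rw [volume_pi, Measure.restrict_pi_pi, integral_finsetSum]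
  · refine Finset.sum_congr rfl fun a _ => ?_
    rw [integral_const_mul, integral_fintype_prod_eq_prod
      (fun j (t : ℝ) => 1 / (π * √(1 - t ^ 2)) * t ^ a j), mul_assoc]
  · intro a _
    exact (Integrable.fintype_prod (f := fun j (t : ℝ) => 1 / (π * √(1 - t ^ 2)) * t ^ a j)
      fun j => integrable_arcsin_mul_pow (a j)).const_mul _

/-- The `2k`-th moment of the randomly weighted average `S_n = R_1 X_1 + ⋯ + R_n X_n`
of `n` i.i.d. Arcsin(-1,1) random variables with Dirichlet(1,...,1) weights equals the
`2k`-th moment of the power semicircle distribution with `λ = (n-1)/2`, namely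
`Γ(k + 1/2) Γ(n/2 + 1/2) / (√π Γ(k + n/2 + 1/2))`. -/
theorem rwa_even_moment (n : ℕ) (hn : 2 ≤ n) (k : ℕ) :
    (∫ p in {p : Fin (n - 1) → ℝ | (∀ j, 0 ≤ p j) ∧ ∑ j, p j ≤ 1},
        ((n - 1).factorial : ℝ) *
          ∫ x in Set.univ.pi fun _ : Fin n => Set.Ioo (-1 : ℝ) 1,
            (∏ j, 1 / (Real.pi * Real.sqrt (1 - x j ^ 2))) *
              ((∑ j : Fin (n - 1), p j * x (Fin.castLE (Nat.sub_le n 1) j)) +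
                (1 - ∑ j, p j) * x ⟨n - 1, by omega⟩) ^ (2 * k))
      = Real.Gamma ((k : ℝ) + 1 / 2) * Real.Gamma ((n : ℝ) / 2 + 1 / 2) /
          (Real.sqrt Real.pi * Real.Gamma ((k : ℝ) + (n : ℝ) / 2 + 1 / 2)) := by
  obtain ⟨m, rfl⟩ : ∃ m, n = m + 1 := ⟨n - 1, by omega⟩
  set μ : ℕ → ℝ := fun a => ∫ x in Set.Ioo (-1 : ℝ) 1, 1 / (Real.pi * √(1 - x ^ 2)) * x ^ a with hμ
  have hμ' : ∀ a, μ a = _ := arcsin_moment_eq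
  have h0 : μ 0 = 1 := by
    have := Real.pi_ne_zero
    simp [hμ', this]
  have h1 : μ 1 = 0 := by simp [hμ']
  have h2 : ∀ a : ℕ, (a + 2) * μ (a + 2) = (a + 1) * μ a := fun a => by
    rw [hμ', hμ', ← mul_div_assoc, integral_cos_pow_add_two, mul_div_assoc]
  rw [← coeff_two_mul_mk_pow h0 h1 h2 m k, ← coeff_mk_pow_eq_sum_piAntidiag, Finset.mul_sum]
  change ∫ p in {p : Fin m → ℝ | (∀ j, 0 ≤ p j) ∧ ∑ j, p j ≤ 1}, (m.factorial : ℝ) *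
    ∫ x in Set.univ.pi fun _ : Fin (m + 1) => Set.Ioo (-1 : ℝ) 1,
      (∏ j, 1 / (Real.pi * √(1 - x j ^ 2))) *
        ((∑ j : Fin m, p j * x j.castSucc) + (1 - ∑ j, p j) * x (Fin.last m)) ^ (2 * k) = _
  have hinner : ∀ p : Fin m → ℝ, (m.factorial : ℝ) *
      ∫ x in Set.univ.pi fun _ : Fin (m + 1) => Set.Ioo (-1 : ℝ) 1,
        (∏ j, 1 / (Real.pi * √(1 - x j ^ 2))) *
          ((∑ j : Fin m, p j * x j.castSucc) + (1 - ∑ j, p j) * x (Fin.last m)) ^ (2 * k)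
      = ∑ a ∈ Finset.piAntidiag (Finset.univ : Finset (Fin (m + 1))) (2 * k),
          (m.factorial * Nat.multinomial Finset.univ a * ∏ j, μ (a j)) *
            ((∏ j : Fin m, p j ^ a j.castSucc) * (1 - ∑ j, p j) ^ a (Fin.last m)) := by
    intro p
    have := integral_arcsin_weighted_sum_pow (Fin.snoc p (1 - ∑ j, p j) : Fin (m + 1) → ℝ) (2 * k)
    simp only [Fin.sum_univ_castSucc (n := m), Fin.snoc_castSucc, Fin.snoc_last] at this
    rw [this, Finset.mul_sum]
    refine Finset.sum_congr rfl fun a _ => ?_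
    rw [Fin.prod_univ_castSucc (fun j => (Fin.snoc p _ : Fin (m + 1) → ℝ) j ^ a j)]
    simp only [Fin.snoc_castSucc, Fin.snoc_last, hμ]
    ring
  simp_rw [hinner]
  rw [integral_finsetSum]
  · refine Finset.sum_congr rfl fun a ha => ?_
    have hsum : ∑ j : Fin m, a j.castSucc + a (Fin.last m) = 2 * k := by
      rw [← Fin.sum_univ_castSucc]
      exact (Finset.mem_piAntidiag.mp ha).1
    have hmul : ((∏ j : Fin m, (a j.castSucc).factorial : ℕ) : ℝ) * (a (Fin.last m)).factorial
        * Nat.multinomial Finset.univ a = (2 * k).factorial := by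
      have := Nat.multinomial_spec Finset.univ a
      rw [(Finset.mem_piAntidiag.mp ha).1, Fin.prod_univ_castSucc] at this
      exact_mod_cast this
    rw [integral_const_mul, integral_solid_simplex_prod_pow m _ _ zero_le_one, hsum, one_pow,
      mul_one, ← hmul]
    ring
  · intro a _
    exact ContinuousOn.integrableOn_compact (isCompact_solid_simplex _ _) (by fun_prop)
end

section
/- Let n ≥ 2. Let μ be the probability measure on ℝ^{n-1} × ℝ^n given by the product of the Dirichlet(1,...,1) measure (density (n−1)! on the simplex Δ ⊂ ℝ^{n-1} with respect to Lebesgue measure) and the n-fold product of the Arcsin distribution on (−1, 1). Then the pushforward of μ under the map ((r_1, ..., r_{n-1}), (x_1, ..., x_n)) ↦ r_1 x_1 + ⋯ + r_{n-1} x_{n-1} + (1 − r_1 − ⋯ − r_{n-1}) x_n is the power semicircle distribution on (−1, 1) with parameter λ = (n−1)/2, i.e. the measure on ℝ with density f(x; λ) = (1/√π) · (Γ(λ + 1)/Γ(λ + 1/2)) · (1 − x²)^{λ − 1/2} on (−1, 1) with respect to Lebesgue measure. -/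
open MeasureTheory

/-- The Arcsin distribution on `(-1, 1)`: density `x ↦ 1/(π √(1 - x²))` on `(-1, 1)`
(and `0` elsewhere) with respect to Lebesgue measure. -/
noncomputable def arcsinMeasure : Measure ℝ :=
  volume.withDensity fun x =>
    ENNReal.ofReal (Set.indicator (Set.Ioo (-1 : ℝ) 1)
      (fun x => 1 / (Real.pi * Real.sqrt (1 - x ^ 2))) x)

/-- The power semicircle distribution on `(-1, 1)` with parameter `λ`: density
`(1/√π) (Γ(λ+1)/Γ(λ+1/2)) (1 - x²)^{λ-1/2}` on `(-1, 1)` with respect to Lebesgue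
measure. -/
noncomputable def powerSemicircle (lam : ℝ) : Measure ℝ :=
  volume.withDensity fun x =>
    ENNReal.ofReal (Set.indicator (Set.Ioo (-1 : ℝ) 1)
      (fun x => (1 / Real.sqrt Real.pi) * (Real.Gamma (lam + 1) / Real.Gamma (lam + 1 / 2)) *
        (1 - x ^ 2) ^ (lam - 1 / 2)) x)

/-- The Dirichlet(1, ..., 1) distribution on the `m`-dimensional simplex: constant
density `m!` on `Δ = {p : ∀ j, p j ≥ 0, ∑ j, p j ≤ 1}` with respect to Lebesgue
measure on `ℝ^m`. -/
noncomputable def dirichletOnes (m : ℕ) : Measure (Fin m → ℝ) :=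
  (m.factorial : ENNReal) • volume.restrict {p | (∀ j, 0 ≤ p j) ∧ ∑ j, p j ≤ 1}

/-- The density of the power semicircle distribution. -/
noncomputable def semicircleDensity (lam x : ℝ) : ℝ :=
  Set.indicator (Set.Ioo (-1 : ℝ) 1)
    (fun x => (1 / Real.sqrt Real.pi) * (Real.Gamma (lam + 1) / Real.Gamma (lam + 1 / 2)) *
      (1 - x ^ 2) ^ (lam - 1 / 2)) x

lemma powerSemicircle_eq_withDensity (lam : ℝ) :
    powerSemicircle lam =
      volume.withDensity fun x => ENNReal.ofReal (semicircleDensity lam x) := rfl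

lemma arcsinMeasure_eq_powerSemicircle : arcsinMeasure = powerSemicircle 0 := by
  unfold arcsinMeasure powerSemicircle
  congr 1
  funext x
  congr 1
  refine congrFun (Set.indicator_congr fun x hx => ?_) x
  have h : 0 < 1 - x ^ 2 := by nlinarith [hx.1, hx.2]
  rw [zero_add, zero_add, zero_sub, Real.Gamma_one, Real.Gamma_one_half_eq,
    Real.rpow_neg h.le, ← Real.sqrt_eq_rpow]
  have := Real.sq_sqrt Real.pi_pos.le
  have h1 : 0 < √Real.pi := Real.sqrt_pos.2 Real.pi_pos
  have h2 : 0 < √(1 - x ^ 2) := Real.sqrt_pos.2 h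
  field_simp
  linarith

lemma semicircleDensity_of_notMem {lam x : ℝ} (hx : x ∉ Set.Ioo (-1 : ℝ) 1) :
    semicircleDensity lam x = 0 := Set.indicator_of_notMem hx _

lemma measurable_semicircleDensity (lam : ℝ) : Measurable (semicircleDensity lam) := by
  unfold semicircleDensity
  exact Measurable.indicator (by fun_prop) measurableSet_Ioo

lemma semicircleDensity_nonneg {lam : ℝ} (h : 0 ≤ lam) (x : ℝ) :
    0 ≤ semicircleDensity lam x := by
  refine Set.indicator_nonneg (fun x hx => ?_) x
  have h1 : 0 < 1 - x ^ 2 := by nlinarith [hx.1, hx.2]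
  have := Real.Gamma_pos_of_pos (show 0 < lam + 1 by linarith)
  have := Real.Gamma_pos_of_pos (show 0 < lam + 1 / 2 by linarith)
  positivity

lemma semicircleDensity_eq_betaPDFReal {lam : ℝ} (h : 0 ≤ lam) (x : ℝ) :
    semicircleDensity lam x = 1 / 2 *
      ProbabilityTheory.betaPDFReal (lam + 1 / 2) (lam + 1 / 2) (1 / 2 * x + 1 / 2) := by
  unfold ProbabilityTheory.betaPDFReal
  split_ifs with hx
  · have hx' : x ∈ Set.Ioo (-1 : ℝ) 1 := ⟨by linarith, by linarith⟩
    have e : 1 - x ^ 2 = 2 ^ (2 : ℝ) * ((1 / 2 * x + 1 / 2) * (1 - (1 / 2 * x + 1 / 2))) := by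
      norm_num
      ring
    have hΓ := Real.Gamma_mul_Gamma_add_half (lam + 1 / 2)
    have g1 := Real.Gamma_pos_of_pos (show 0 < lam + 1 / 2 by linarith)
    have g2 := Real.Gamma_pos_of_pos (show 0 < 2 * (lam + 1 / 2) by linarith)
    have hp : 0 < √Real.pi := Real.sqrt_pos.2 Real.pi_pos
    have a1 := hx.1
    have a2 : 0 < 1 - (1 / 2 * x + 1 / 2) := by linarith [hx.2]
    rw [semicircleDensity, Set.indicator_of_mem hx', e, Real.mul_rpow (by positivity) (by positivity),
      Real.mul_rpow a1.le a2.le, ProbabilityTheory.beta, ← Real.rpow_mul (by norm_num),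
      ← two_mul (lam + 1 / 2), show lam + 1 / 2 - 1 = lam - 1 / 2 by ring]
    rw [show lam + 1 / 2 + 1 / 2 = lam + 1 by ring,
      show 1 - 2 * (lam + 1 / 2) = -(2 * lam) by ring, Real.rpow_neg (by norm_num)] at hΓ
    rw [show 2 * (lam - 1 / 2) = 2 * lam - 1 by ring, Real.rpow_sub_one (by norm_num)]
    have h2 : (0 : ℝ) < 2 ^ (2 * lam) := by positivity
    generalize (1 / 2 * x + 1 / 2) ^ (lam - 1 / 2) = p
    generalize (1 - (1 / 2 * x + 1 / 2)) ^ (lam - 1 / 2) = q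
    generalize (2 : ℝ) ^ (2 * lam) = t at *
    field_simp at hΓ ⊢
    linear_combination p * q * hΓ
  · rw [semicircleDensity_of_notMem, mul_zero]
    rintro ⟨h1, h2⟩
    exact hx ⟨by linarith, by linarith⟩

lemma integrable_betaPDFReal {a : ℝ} (ha : 0 < a) :
    Integrable (ProbabilityTheory.betaPDFReal a a) := by
  refine ⟨by fun_prop, ?_⟩
  rw [hasFiniteIntegral_iff_ofReal]
  · exact (ProbabilityTheory.lintegral_betaPDF_eq_one ha ha).trans_lt ENNReal.one_lt_top
  · refine Filter.Eventually.of_forall fun x => ?_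
    by_cases hx : 0 < x ∧ x < 1
    · exact (ProbabilityTheory.betaPDFReal_pos hx.1 hx.2 ha ha).le
    · simp [ProbabilityTheory.betaPDFReal, hx]

lemma integral_betaPDFReal {a : ℝ} (ha : 0 < a) :
    ∫ x, ProbabilityTheory.betaPDFReal a a x = 1 := by
  rw [integral_eq_lintegral_of_nonneg_ae _ (by fun_prop)]
  · exact (ENNReal.toReal_eq_one_iff _).2 (ProbabilityTheory.lintegral_betaPDF_eq_one ha ha)
  · refine Filter.Eventually.of_forall fun x => ?_
    by_cases hx : 0 < x ∧ x < 1
    · exact (ProbabilityTheory.betaPDFReal_pos hx.1 hx.2 ha ha).le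
    · simp [ProbabilityTheory.betaPDFReal, hx]

lemma integrable_semicircleDensity {lam : ℝ} (h : 0 ≤ lam) :
    Integrable (semicircleDensity lam) := by
  rw [funext (semicircleDensity_eq_betaPDFReal h)]
  exact (((integrable_betaPDFReal (a := lam + 1 / 2) (by linarith)).comp_add_right
    (1 / 2)).comp_mul_left' (by norm_num : (1 / 2 : ℝ) ≠ 0)).const_mul _

lemma integral_semicircleDensity {lam : ℝ} (h : 0 ≤ lam) :
    ∫ x, semicircleDensity lam x = 1 := by
  rw [funext (semicircleDensity_eq_betaPDFReal h), integral_const_mul,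
    Measure.integral_comp_mul_left (fun x =>
      ProbabilityTheory.betaPDFReal (lam + 1 / 2) (lam + 1 / 2) (x + 1 / 2)),
    integral_add_right_eq_self, integral_betaPDFReal (by linarith)]
  norm_num

lemma integrable_semicircleDensity_mul_pow {lam : ℝ} (h : 0 ≤ lam) (k : ℕ) :
    Integrable fun x => semicircleDensity lam x * x ^ k := by
  refine (integrable_semicircleDensity h).mono
    ((measurable_semicircleDensity lam).mul (by fun_prop)).aestronglyMeasurable
    (Filter.Eventually.of_forall fun x => ?_)
  by_cases hx : x ∈ Set.Ioo (-1 : ℝ) 1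
  · rw [norm_mul, norm_pow]
    exact mul_le_of_le_one_right (norm_nonneg _)
      (pow_le_one₀ (norm_nonneg _) (abs_le.2 ⟨hx.1.le, hx.2.le⟩))
  · simp [semicircleDensity_of_notMem hx]

lemma integral_powerSemicircle {lam : ℝ} (h : 0 ≤ lam) (g : ℝ → ℝ) :
    ∫ x, g x ∂powerSemicircle lam = ∫ x, semicircleDensity lam x * g x := by
  rw [powerSemicircle_eq_withDensity, integral_withDensity_eq_integral_toReal_smul
    (measurable_semicircleDensity lam).ennreal_ofReal (by simp)]
  simp [ENNReal.toReal_ofReal (semicircleDensity_nonneg h _)]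

lemma isProbabilityMeasure_powerSemicircle {lam : ℝ} (h : 0 ≤ lam) :
    IsProbabilityMeasure (powerSemicircle lam) := by
  constructor
  rw [powerSemicircle_eq_withDensity, withDensity_apply _ MeasurableSet.univ,
    Measure.restrict_univ, ← ofReal_integral_eq_lintegral_ofReal (integrable_semicircleDensity h)
      (Filter.Eventually.of_forall (semicircleDensity_nonneg h)), integral_semicircleDensity h,
    ENNReal.ofReal_one]

lemma ae_powerSemicircle_mem_Icc (lam : ℝ) :
    ∀ᵐ x ∂powerSemicircle lam, x ∈ Set.Icc (-1 : ℝ) 1 := by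
  rw [powerSemicircle_eq_withDensity,
    ae_withDensity_iff (measurable_semicircleDensity lam).ennreal_ofReal]
  refine Filter.Eventually.of_forall fun x hx => Set.Ioo_subset_Icc_self ?_
  by_contra hx'
  exact hx (by rw [semicircleDensity_of_notMem hx', ENNReal.ofReal_zero])

/-- Integration by parts against the power semicircle density. -/
lemma integral_semicircleDensity_mul_deriv {lam : ℝ} (h : 0 ≤ lam) {p p' : ℝ → ℝ}
    (hp : ∀ x, HasDerivAt p (p' x) x)
    (hint : Integrable fun x =>
      semicircleDensity lam x * (p' x * (1 - x ^ 2) - (2 * lam + 1) * (x * p x))) :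
    ∫ x, semicircleDensity lam x * (p' x * (1 - x ^ 2) - (2 * lam + 1) * (x * p x)) = 0 := by
  set c := (1 / Real.sqrt Real.pi) * (Real.Gamma (lam + 1) / Real.Gamma (lam + 1 / 2)) with hc
  have hcont : Continuous p := continuous_iff_continuousAt.2 fun x => (hp x).continuousAt
  rw [← setIntegral_eq_integral_of_forall_compl_eq_zero (s := Set.Ioc (-1 : ℝ) 1),
    ← intervalIntegral.integral_of_le (by norm_num),
    intervalIntegral.integral_eq_sub_of_hasDerivAt_of_le
      (f := fun x => c * (p x * (1 - x ^ 2) ^ (lam + 1 / 2))) (by norm_num) ?_ ?_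
      hint.intervalIntegrable]
  · norm_num
    rw [Real.zero_rpow (by linarith)]
    simp
  · refine Continuous.continuousOn ?_
    exact continuous_const.mul (hcont.mul
      ((by fun_prop : Continuous fun x : ℝ => 1 - x ^ 2).rpow_const fun x => Or.inr (by linarith)))
  · intro x hx
    have hpos : 0 < 1 - x ^ 2 := by nlinarith [hx.1, hx.2]
    have h1 : HasDerivAt (fun x : ℝ => 1 - x ^ 2) (-(2 * x)) x := by
      simpa using ((hasDerivAt_pow 2 x).const_sub 1)
    have h2 := h1.rpow_const (p := lam + 1 / 2) (Or.inl hpos.ne')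
    refine (((hp x).mul h2).const_mul c).congr_deriv ?_
    rw [show semicircleDensity lam x = c * (1 - x ^ 2) ^ (lam - 1 / 2) from
        Set.indicator_of_mem hx _, show lam + 1 / 2 = lam - 1 / 2 + 1 by ring, Real.rpow_add_one hpos.ne',
      show lam - 1 / 2 + 1 - 1 = lam - 1 / 2 by ring]
    ring
  · intro x hx
    rw [semicircleDensity_of_notMem, zero_mul]
    exact fun h' => hx ⟨h'.1, h'.2.le⟩

lemma integral_powerSemicircle_pow_one {lam : ℝ} (h : 0 ≤ lam) :
    ∫ x, x ^ 1 ∂powerSemicircle lam = 0 := by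
  have e : (fun x => semicircleDensity lam x * (0 * (1 - x ^ 2) - (2 * lam + 1) * (x * 1))) =
      fun x => -(2 * lam + 1) * (semicircleDensity lam x * x ^ 1) := by
    funext x
    ring
  have := integral_semicircleDensity_mul_deriv h (p := fun _ => 1) (p' := fun _ => 0)
    (fun x => hasDerivAt_const x 1)
    (by rw [e]; exact (integrable_semicircleDensity_mul_pow h 1).const_mul _)
  rw [e, integral_const_mul] at this
  rw [integral_powerSemicircle h]
  exact (mul_eq_zero.1 this).resolve_left (by linarith)

lemma integral_powerSemicircle_pow_add_two {lam : ℝ} (h : 0 ≤ lam) (k : ℕ) :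
    (k + 2 + 2 * lam) * ∫ x, x ^ (k + 2) ∂powerSemicircle lam =
      (k + 1) * ∫ x, x ^ k ∂powerSemicircle lam := by
  have e : (fun x => semicircleDensity lam x * (((k + 1 : ℕ) : ℝ) * x ^ k * (1 - x ^ 2)
        - (2 * lam + 1) * (x * x ^ (k + 1)))) =
      fun x => (k + 1) * (semicircleDensity lam x * x ^ k) -
        (k + 2 + 2 * lam) * (semicircleDensity lam x * x ^ (k + 2)) := by
    funext x
    push_cast
    ring
  have i1 := (integrable_semicircleDensity_mul_pow h k).const_mul ((k : ℝ) + 1)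
  have i2 := (integrable_semicircleDensity_mul_pow h (k + 2)).const_mul ((k : ℝ) + 2 + 2 * lam)
  have := integral_semicircleDensity_mul_deriv h (p := fun x => x ^ (k + 1))
    (p' := fun x => ((k + 1 : ℕ) : ℝ) * x ^ k) (fun x => hasDerivAt_pow (k + 1) x)
    (by rw [e]; exact i1.sub i2)
  rw [e, integral_sub i1 i2, integral_const_mul, integral_const_mul] at this
  rw [integral_powerSemicircle h, integral_powerSemicircle h]
  linarith

lemma integrable_of_ae_mem_Icc {μ : Measure ℝ} [IsFiniteMeasure μ] {a b : ℝ}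
    (hμ : ∀ᵐ x ∂μ, x ∈ Set.Icc a b) {f : ℝ → ℝ} (hf : Continuous f) : Integrable f μ := by
  obtain ⟨C, hC⟩ := isCompact_Icc.exists_bound_of_continuousOn (hf.continuousOn (s := Set.Icc a b))
  exact Integrable.of_bound hf.aestronglyMeasurable C (hμ.mono hC)

/-- Finite measures supported in a compact interval are determined by their moments. -/
lemma Measure.ext_of_moments {μ ν : Measure ℝ} [IsFiniteMeasure μ] [IsFiniteMeasure ν] {a b : ℝ}
    (hμ : ∀ᵐ x ∂μ, x ∈ Set.Icc a b) (hν : ∀ᵐ x ∂ν, x ∈ Set.Icc a b)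
    (h : ∀ k : ℕ, ∫ x, x ^ k ∂μ = ∫ x, x ^ k ∂ν) : μ = ν := by
  have poly (p : Polynomial ℝ) : ∫ x, p.eval x ∂μ = ∫ x, p.eval x ∂ν := by
    simp_rw [Polynomial.eval_eq_sum_range]
    rw [integral_finsetSum _ fun i _ => integrable_of_ae_mem_Icc hμ (by fun_prop),
      integral_finsetSum _ fun i _ => integrable_of_ae_mem_Icc hν (by fun_prop)]
    simp_rw [integral_const_mul, h]
  have approx {ρ : Measure ℝ} [IsFiniteMeasure ρ] (hρ : ∀ᵐ x ∂ρ, x ∈ Set.Icc a b)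
      {f : ℝ → ℝ} (hf : Continuous f) {ε : ℝ} {p : Polynomial ℝ}
      (hp : ∀ x ∈ Set.Icc a b, |p.eval x - f x| < ε) :
      |∫ x, p.eval x ∂ρ - ∫ x, f x ∂ρ| ≤ ε * ρ.real Set.univ := by
    rw [← integral_sub (integrable_of_ae_mem_Icc hρ p.continuous) (integrable_of_ae_mem_Icc hρ hf)]
    exact norm_integral_le_of_norm_le_const (f := fun x => p.eval x - f x)
      (hρ.mono fun x hx => (hp x hx).le)
  refine ext_of_forall_integral_eq_of_IsFiniteMeasure fun f => ?_
  refine eq_of_abs_sub_le_all fun ε hε => ?_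
  set M := μ.real Set.univ + ν.real Set.univ + 1 with hM
  have hMpos : 0 < M := by positivity
  obtain ⟨p, hp⟩ := exists_polynomial_near_of_continuousOn a b f f.continuous.continuousOn
    (ε / M) (by positivity)
  have h1 := approx hμ f.continuous hp
  have h2 := approx hν f.continuous hp
  rw [poly p] at h1
  have h3 : ε / M * μ.real Set.univ + ε / M * ν.real Set.univ + ε / M = ε := by
    rw [← mul_add, ← mul_add_one, ← hM, div_mul_cancel₀ _ hMpos.ne']
  have h4 : 0 < ε / M := by positivity
  rw [abs_le] at h1 h2 ⊢
  constructor <;> linarith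

/-- The simplex of size `s` in `ℝ^m` with one vertex at the origin. -/
def cornerSimplex (m : ℕ) (s : ℝ) : Set (Fin m → ℝ) :=
  {p | (∀ j, 0 ≤ p j) ∧ ∑ j, p j ≤ s}

lemma isCompact_cornerSimplex (m : ℕ) (s : ℝ) : IsCompact (cornerSimplex m s) := by
  refine (isCompact_Icc (a := (0 : Fin m → ℝ)) (b := fun _ => s)).of_isClosed_subset ?_ ?_
  · have : cornerSimplex m s = (⋂ j, {p | 0 ≤ p j}) ∩ {p | ∑ j, p j ≤ s} := by
      ext p
      simp [cornerSimplex]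
    rw [this]
    exact (isClosed_iInter fun j => isClosed_le (by fun_prop) (by fun_prop)).inter
      (isClosed_le (by fun_prop) (by fun_prop))
  · exact fun p hp => ⟨hp.1, fun j =>
      (Finset.single_le_sum (fun i _ => hp.1 i) (Finset.mem_univ j)).trans hp.2⟩

lemma measurableSet_cornerSimplex (m : ℕ) (s : ℝ) : MeasurableSet (cornerSimplex m s) :=
  (isCompact_cornerSimplex m s).isClosed.measurableSet

lemma cons_mem_cornerSimplex {m : ℕ} {s u : ℝ} {p : Fin m → ℝ} :
    (Fin.cons u p : Fin (m + 1) → ℝ) ∈ cornerSimplex (m + 1) s ↔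
      0 ≤ u ∧ p ∈ cornerSimplex m (s - u) := by
  simp [cornerSimplex, Fin.forall_fin_succ, Fin.sum_univ_succ, le_sub_iff_add_le', and_assoc]

lemma cornerSimplex_of_neg {m : ℕ} {s : ℝ} (hs : s < 0) : cornerSimplex m s = ∅ :=
  Set.eq_empty_of_forall_notMem fun _ hp =>
    hs.not_ge ((Finset.sum_nonneg fun j _ => hp.1 j).trans hp.2)

/-- Slicing the simplex along its first coordinate. -/
lemma integral_cornerSimplex_succ (m : ℕ) {s : ℝ} (hs : 0 ≤ s) {g : (Fin (m + 1) → ℝ) → ℝ}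
    (hg : Continuous g) :
    ∫ r in cornerSimplex (m + 1) s, g r =
      ∫ u in (0 : ℝ)..s, ∫ r in cornerSimplex m (s - u), g (Fin.cons u r) := by
  have hmp := (volume_preserving_piFinSuccAbove (fun _ : Fin (m + 1) => ℝ) 0).symm
  have hint : Integrable ((cornerSimplex (m + 1) s).indicator g) :=
    (hg.continuousOn.integrableOn_compact (isCompact_cornerSimplex _ _)).integrable_indicator
      (measurableSet_cornerSimplex _ _)
  rw [← integral_indicator (measurableSet_cornerSimplex _ _), ← hmp.integral_comp',
    Measure.volume_eq_prod, integral_prod, intervalIntegral.integral_of_le hs,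
    ← integral_Icc_eq_integral_Ioc, ← integral_indicator measurableSet_Icc]
  · refine integral_congr_ae (Filter.Eventually.of_forall fun u => ?_)
    have hcons (r : Fin m → ℝ) :
        (MeasurableEquiv.piFinSuccAbove (fun _ : Fin (m + 1) => ℝ) 0).symm (u, r) =
          Fin.cons u r := by
      simp [MeasurableEquiv.piFinSuccAbove, Fin.insertNthEquiv]
    simp only [hcons]
    by_cases hu : 0 ≤ u
    · have e : (fun r : Fin m → ℝ => (cornerSimplex (m + 1) s).indicator g (Fin.cons u r)) =
          (cornerSimplex m (s - u)).indicator fun r => g (Fin.cons u r) := by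
        funext r
        by_cases hr : r ∈ cornerSimplex m (s - u)
        · rw [Set.indicator_of_mem hr, Set.indicator_of_mem (cons_mem_cornerSimplex.2 ⟨hu, hr⟩)]
        · rw [Set.indicator_of_notMem hr,
            Set.indicator_of_notMem fun h => hr (cons_mem_cornerSimplex.1 h).2]
      rw [e, integral_indicator (measurableSet_cornerSimplex _ _)]
      by_cases hus : u ≤ s
      · rw [Set.indicator_of_mem (show u ∈ Set.Icc 0 s from ⟨hu, hus⟩)]
      · rw [Set.indicator_of_notMem fun h => hus h.2,
          cornerSimplex_of_neg (by linarith), setIntegral_empty]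
    · rw [Set.indicator_of_notMem fun h => hu h.1]
      simp [Set.indicator_of_notMem fun h => hu (cons_mem_cornerSimplex.1 h).1]
  · exact (hmp.integrable_comp_emb (MeasurableEquiv.measurableEmbedding _)).2 hint

lemma integral_pow_mul_sub_pow_s9 (s : ℝ) (i j : ℕ) :
    ∫ u in (0 : ℝ)..s, u ^ i * (s - u) ^ j =
      s ^ (i + j + 1) * (i.factorial * j.factorial / (i + j + 1).factorial) := by
  induction i generalizing j with
  | zero =>
    have h := intervalIntegral.integral_comp_sub_left (fun x : ℝ => x ^ j) (a := 0) (b := s) s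
    simp only [pow_zero, one_mul, h, integral_pow, sub_self, sub_zero, zero_add,
      Nat.factorial_succ, Nat.factorial_zero]
    have := j.factorial_ne_zero
    push_cast
    field_simp
    simp
  | succ i ih =>
    have h := intervalIntegral.integral_deriv_eq_sub' (a := (0 : ℝ)) (b := s)
      (fun u => u ^ (i + 1) * (s - u) ^ (j + 1))
      (f' := fun u => (i + 1) * (u ^ i * (s - u) ^ (j + 1)) -
        (j + 1) * (u ^ (i + 1) * (s - u) ^ j)) ?_ ?_ ?_
    · rw [intervalIntegral.integral_sub (Continuous.intervalIntegrable (by fun_prop) _ _)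
        (Continuous.intervalIntegrable (by fun_prop) _ _), intervalIntegral.integral_const_mul,
        intervalIntegral.integral_const_mul, ih] at h
      simp only [sub_self, ne_eq, Nat.add_eq_zero_iff, one_ne_zero, and_false, not_false_eq_true,
        zero_pow, mul_zero, zero_mul] at h
      have e : i + (j + 1) + 1 = i + 1 + j + 1 := by ring
      rw [e, Nat.factorial_succ j] at h
      rw [Nat.factorial_succ i]
      have hj : (j : ℝ) + 1 ≠ 0 := by positivity
      push_cast at h ⊢
      apply mul_left_cancel₀ hj
      linear_combination -h
    · funext u
      have h1 : HasDerivAt (fun u : ℝ => s - u) (-1) u := (hasDerivAt_id u).const_sub s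
      refine (((hasDerivAt_pow (i + 1) u).mul (h1.pow (j + 1))).congr_deriv ?_).deriv
      simp
      ring
    · intro u _
      fun_prop
    · fun_prop

/-- Hermite–Genocchi formula for monomials, the complete homogeneous symmetric polynomials of the
nodes being written as coefficients of a product of geometric series. -/
lemma integral_cornerSimplex_pow (m k : ℕ) {s : ℝ} (hs : 0 ≤ s) (x : Fin (m + 1) → ℝ) :
    ∫ r in cornerSimplex m s,
        (∑ j, r j * x j.castSucc + (s - ∑ j, r j) * x (Fin.last m)) ^ k =
      s ^ (m + k) * (k.factorial / (m + k).factorial) *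
        PowerSeries.coeff k (∏ j, PowerSeries.mk fun i => x j ^ i) := by
  induction m generalizing k s with
  | zero =>
    have : cornerSimplex 0 s = Set.univ := Set.eq_univ_of_forall fun p => by
      simpa [cornerSimplex] using hs
    have := k.factorial_ne_zero
    simp [*, mul_pow, Measure.real, volume_pi]
  | succ m ih =>
    rw [integral_cornerSimplex_succ m hs (by fun_prop)]
    have slice (u : ℝ) (hu : u ∈ Set.uIcc 0 s) :
        ∫ r in cornerSimplex m (s - u), (∑ j, (Fin.cons u r : Fin (m + 1) → ℝ) j * x j.castSucc +
            (s - ∑ j, (Fin.cons u r : Fin (m + 1) → ℝ) j) * x (Fin.last (m + 1))) ^ k =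
          ∑ p ∈ Finset.HasAntidiagonal.antidiagonal k, u ^ p.1 * (s - u) ^ (m + p.2) *
            (x 0 ^ p.1 * (k.choose p.1 * (p.2.factorial / (m + p.2).factorial)) *
              PowerSeries.coeff p.2 (∏ j : Fin (m + 1), PowerSeries.mk fun i => x j.succ ^ i)) := by
      rw [Set.uIcc_of_le hs] at hu
      have e (r : Fin m → ℝ) : (∑ j, (Fin.cons u r : Fin (m + 1) → ℝ) j * x j.castSucc +
            (s - ∑ j, (Fin.cons u r : Fin (m + 1) → ℝ) j) * x (Fin.last (m + 1))) ^ k =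
          ∑ p ∈ Finset.HasAntidiagonal.antidiagonal k, k.choose p.1 * (u * x 0) ^ p.1 *
            (∑ j, r j * x j.castSucc.succ +
              (s - u - ∑ j, r j) * x (Fin.last m).succ) ^ p.2 := by
        simp_rw [mul_assoc, ← nsmul_eq_mul, ← (Commute.all (u * x 0) _).add_pow',
          Fin.sum_univ_succ, Fin.cons_zero, Fin.cons_succ, Fin.castSucc_zero,
          Fin.succ_castSucc, Fin.succ_last]
        ring
      simp_rw [e]
      rw [integral_finsetSum]
      · refine Finset.sum_congr rfl fun p _ => ?_
        rw [integral_const_mul, ih p.2 (sub_nonneg.2 hu.2) fun j => x j.succ]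
        ring
      · intro p _
        exact ContinuousOn.integrableOn_compact (isCompact_cornerSimplex _ _)
          (Continuous.continuousOn (by fun_prop))
    rw [intervalIntegral.integral_congr slice, intervalIntegral.integral_finsetSum
      fun p _ => Continuous.intervalIntegrable (by fun_prop) _ _,
      Fin.prod_univ_succ (fun j => PowerSeries.mk fun i => x j ^ i), PowerSeries.coeff_mul, Finset.mul_sum]
    refine Finset.sum_congr rfl fun p hp => ?_
    rw [Finset.HasAntidiagonal.mem_antidiagonal] at hp
    rw [intervalIntegral.integral_mul_const, integral_pow_mul_sub_pow_s9, PowerSeries.coeff_mk]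
    obtain ⟨i, j⟩ := p
    subst hp
    rw [show i + (m + j) + 1 = m + 1 + (i + j) by ring, Nat.cast_choose ℝ (Nat.le_add_right i j), Nat.add_sub_cancel_left]
    have h1 := i.factorial_ne_zero
    have h2 := j.factorial_ne_zero
    have h3 := (m + j).factorial_ne_zero
    field_simp

/-- The differential equation `(1 - X²) M' = a X M`, read off on coefficients. -/
lemma one_sub_X_sq_mul_derivative_eq_iff (M : PowerSeries ℝ) (a : ℝ) :
    (1 - PowerSeries.X ^ 2) * PowerSeries.derivative ℝ M = a • (PowerSeries.X * M) ↔
      PowerSeries.coeff 1 M = 0 ∧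
        ∀ k : ℕ, (k + 2) * PowerSeries.coeff (k + 2) M = (a + k) * PowerSeries.coeff k M := by
  have e : (1 - PowerSeries.X ^ 2) * PowerSeries.derivative ℝ M =
      PowerSeries.derivative ℝ M -
        PowerSeries.X * (PowerSeries.X * PowerSeries.derivative ℝ M) := by ring
  have h0 : PowerSeries.coeff 0 ((1 - PowerSeries.X ^ 2) * PowerSeries.derivative ℝ M) =
      PowerSeries.coeff 1 M := by
    rw [e, map_sub, PowerSeries.coeff_zero_X_mul, PowerSeries.coeff_derivative]
    simp
  have hs (k : ℕ) :
      PowerSeries.coeff (k + 1) ((1 - PowerSeries.X ^ 2) * PowerSeries.derivative ℝ M) =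
        (k + 2) * PowerSeries.coeff (k + 2) M - k * PowerSeries.coeff k M := by
    rw [e, map_sub, PowerSeries.coeff_succ_X_mul, PowerSeries.coeff_derivative]
    rcases k with _ | k
    · rw [PowerSeries.coeff_zero_X_mul]
      push_cast
      ring
    · rw [PowerSeries.coeff_succ_X_mul, PowerSeries.coeff_derivative]
      push_cast
      ring
  constructor
  · intro h
    refine ⟨by rw [← h0, h]; simp, fun k => ?_⟩
    have := hs k
    rw [h, PowerSeries.coeff_smul, PowerSeries.coeff_succ_X_mul, smul_eq_mul] at this
    linarith
  · rintro ⟨h1, h2⟩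
    ext k
    rcases k with _ | k
    · rw [h0, h1, PowerSeries.coeff_smul, PowerSeries.coeff_zero_X_mul, smul_zero]
    · rw [hs, PowerSeries.coeff_smul, PowerSeries.coeff_succ_X_mul, smul_eq_mul, h2]
      ring

lemma one_sub_X_sq_mul_derivative_pow {M : PowerSeries ℝ}
    (hM : (1 - PowerSeries.X ^ 2) * PowerSeries.derivative ℝ M = PowerSeries.X * M) (n : ℕ) :
    (1 - PowerSeries.X ^ 2) * PowerSeries.derivative ℝ (M ^ n) =
      (n : ℝ) • (PowerSeries.X * M ^ n) := by
  rw [Nat.cast_smul_eq_nsmul, nsmul_eq_mul, PowerSeries.derivative_pow]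
  rcases n with _ | n
  · simp
  · rw [Nat.add_sub_cancel]
    linear_combination (n + 1 : ℕ) * M ^ n * hM

lemma integral_coeff_prod_geometric {ρ : Measure ℝ} [SigmaFinite ρ]
    (hρ : ∀ k : ℕ, Integrable (fun x : ℝ => x ^ k) ρ) (n k : ℕ) :
    ∫ x, PowerSeries.coeff k (∏ j, PowerSeries.mk fun i => x j ^ i)
        ∂Measure.pi (fun _ : Fin n => ρ) =
      PowerSeries.coeff k ((PowerSeries.mk fun i => ∫ x, x ^ i ∂ρ) ^ n) := by
  have e : (PowerSeries.mk fun i => ∫ x, x ^ i ∂ρ) ^ n =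
      ∏ _j : Fin n, PowerSeries.mk fun i => ∫ x, x ^ i ∂ρ := by simp
  simp_rw [e, PowerSeries.coeff_prod, PowerSeries.coeff_mk]
  rw [integral_finsetSum _ fun l _ => Integrable.fintype_prod fun i => hρ (l i)]
  exact Finset.sum_congr rfl fun l _ => integral_fintype_prod_eq_prod fun i x => x ^ l i

/-- The moments of the power semicircle distribution in terms of those of the Arcsin
distribution. -/
lemma coeff_arcsin_moments_pow (m k : ℕ) :
    (m.factorial * (k.factorial / (m + k).factorial) : ℝ) *
        PowerSeries.coeff k ((PowerSeries.mk fun i => ∫ x, x ^ i ∂powerSemicircle 0) ^ (m + 1)) =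
      ∫ x, x ^ k ∂powerSemicircle (m / 2) := by
  have hm : (0 : ℝ) ≤ m / 2 := by positivity
  have := isProbabilityMeasure_powerSemicircle le_rfl
  have := isProbabilityMeasure_powerSemicircle hm
  set M : PowerSeries ℝ := PowerSeries.mk fun i => ∫ x, x ^ i ∂powerSemicircle 0 with hM
  have hode : (1 - PowerSeries.X ^ 2) * PowerSeries.derivative ℝ M = PowerSeries.X * M := by
    rw [← one_smul ℝ (PowerSeries.X * M), one_sub_X_sq_mul_derivative_eq_iff]
    simp only [hM, PowerSeries.coeff_mk]
    refine ⟨integral_powerSemicircle_pow_one le_rfl, fun k => ?_⟩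
    have := integral_powerSemicircle_pow_add_two le_rfl k
    rw [mul_zero, add_zero] at this
    rw [this, add_comm 1]
  obtain ⟨h1, h2⟩ := (one_sub_X_sq_mul_derivative_eq_iff _ _).1
    (one_sub_X_sq_mul_derivative_pow hode (m + 1))
  induction k using Nat.twoStepInduction with
  | zero =>
    have := m.factorial_ne_zero
    simp [map_pow, *]
  | one => rw [h1, mul_zero, integral_powerSemicircle_pow_one hm]
  | more k ih _ =>
    have h3 := integral_powerSemicircle_pow_add_two hm k
    rw [← ih] at h3
    have h4 := h2 k
    have h5 : (k : ℝ) + 2 + 2 * (m / 2) ≠ 0 := by positivity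
    apply mul_left_cancel₀ h5
    rw [h3, ← add_assoc, Nat.factorial_succ (k + 1), Nat.factorial_succ k,
      show m + k + 2 = m + k + 1 + 1 from rfl, Nat.factorial_succ (m + k + 1),
      Nat.factorial_succ (m + k)]
    have h6 := (m + k).factorial_ne_zero
    push_cast at h4 ⊢
    field_simp
    linear_combination (k + m + 2 : ℝ) * h4

lemma isFiniteMeasure_dirichletOnes (m : ℕ) : IsFiniteMeasure (dirichletOnes m) := by
  refine ⟨?_⟩
  rw [dirichletOnes, Measure.smul_apply, Measure.restrict_apply_univ]
  exact ENNReal.mul_lt_top (ENNReal.natCast_lt_top _) (isCompact_cornerSimplex m 1).measure_lt_top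

lemma weighted_average_mem_Icc {m : ℕ} {r : Fin m → ℝ} {x : Fin (m + 1) → ℝ}
    (hr : r ∈ cornerSimplex m 1) (hx : ∀ j, x j ∈ Set.Icc (-1 : ℝ) 1) :
    ∑ j, r j * x j.castSucc + (1 - ∑ j, r j) * x (Fin.last m) ∈ Set.Icc (-1 : ℝ) 1 := by
  have h0 : 0 ≤ 1 - ∑ j, r j := sub_nonneg.2 hr.2
  have h1 : ∑ j, r j * x j.castSucc ≤ ∑ j, r j :=
    Finset.sum_le_sum fun j _ => mul_le_of_le_one_right (hr.1 j) (hx _).2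
  have h2 : -∑ j, r j ≤ ∑ j, r j * x j.castSucc := by
    rw [← Finset.sum_neg_distrib]
    exact Finset.sum_le_sum fun j _ => by nlinarith [hr.1 j, (hx j.castSucc).1]
  constructor <;> nlinarith [(hx (Fin.last m)).1, (hx (Fin.last m)).2]

lemma ae_mem_cornerSimplex_prod_pi {m : ℕ} {ρ : Measure ℝ} [IsFiniteMeasure ρ] {s : Set ℝ}
    (hρ : ∀ᵐ x ∂ρ, x ∈ s) :
    ∀ᵐ q ∂(dirichletOnes m).prod (Measure.pi fun _ : Fin (m + 1) => ρ),
      q.1 ∈ cornerSimplex m 1 ∧ ∀ j, q.2 j ∈ s := by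
  have := isFiniteMeasure_dirichletOnes m
  refine Filter.Eventually.and ?_ (Filter.eventually_all.2 fun j => ?_)
  · exact Measure.quasiMeasurePreserving_fst.ae (Measure.ae_smul_measure
      (ae_restrict_mem (measurableSet_cornerSimplex m 1)) _)
  · exact Measure.quasiMeasurePreserving_snd.ae
      ((Measure.quasiMeasurePreserving_eval (fun _ : Fin (m + 1) => ρ) j).ae hρ)

lemma map_weighted_average_eq_powerSemicircle (m : ℕ) :
    Measure.map (fun q : (Fin m → ℝ) × (Fin (m + 1) → ℝ) =>
        ∑ j, q.1 j * q.2 j.castSucc + (1 - ∑ j, q.1 j) * q.2 (Fin.last m))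
      ((dirichletOnes m).prod (Measure.pi fun _ : Fin (m + 1) => arcsinMeasure)) =
      powerSemicircle (m / 2) := by
  have hm : (0 : ℝ) ≤ m / 2 := by positivity
  have := isProbabilityMeasure_powerSemicircle le_rfl
  have := isProbabilityMeasure_powerSemicircle hm
  have := isFiniteMeasure_dirichletOnes m
  rw [arcsinMeasure_eq_powerSemicircle]
  set μ := (dirichletOnes m).prod (Measure.pi fun _ : Fin (m + 1) => powerSemicircle 0)
  set S : (Fin m → ℝ) × (Fin (m + 1) → ℝ) → ℝ := fun q =>
    ∑ j, q.1 j * q.2 j.castSucc + (1 - ∑ j, q.1 j) * q.2 (Fin.last m) with hS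
  have hSc : Continuous S := by fun_prop
  have hSm : AEMeasurable S μ := hSc.measurable.aemeasurable
  have hSae : ∀ᵐ q ∂μ, S q ∈ Set.Icc (-1 : ℝ) 1 :=
    (ae_mem_cornerSimplex_prod_pi (ae_powerSemicircle_mem_Icc 0)).mono fun q hq =>
      weighted_average_mem_Icc hq.1 hq.2
  refine Measure.ext_of_moments ((ae_map_iff hSm measurableSet_Icc).2 hSae)
    (ae_powerSemicircle_mem_Icc _) fun k => ?_
  rw [integral_map hSm (by fun_prop), integral_prod_symm]
  · have inner (x : Fin (m + 1) → ℝ) : ∫ r, S (r, x) ^ k ∂dirichletOnes m =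
        m.factorial * (k.factorial / (m + k).factorial) *
          PowerSeries.coeff k (∏ j, PowerSeries.mk fun i => x j ^ i) := by
      have h := integral_cornerSimplex_pow m k zero_le_one x
      rw [one_pow, one_mul] at h
      rw [dirichletOnes, integral_smul_measure, mul_assoc, ← h, ENNReal.toReal_natCast,
        smul_eq_mul]
      rfl
    simp_rw [inner]
    rw [integral_const_mul, integral_coeff_prod_geometric, coeff_arcsin_moments_pow]
    exact fun k => integrable_of_ae_mem_Icc (ae_powerSemicircle_mem_Icc 0) (by fun_prop)
  · refine Integrable.of_bound (by fun_prop) 1 (hSae.mono fun q hq => ?_)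
    rw [norm_pow]
    exact pow_le_one₀ (norm_nonneg _) (abs_le.2 hq)

/-- Theorem 2.2: the pushforward of the product of the Dirichlet(1,...,1) measure on
the `(n-1)`-dimensional simplex and the `n`-fold product of the Arcsin distribution on
`(-1, 1)` under `((r_1, ..., r_{n-1}), (x_1, ..., x_n)) ↦ r_1 x_1 + ⋯ + r_{n-1} x_{n-1}
+ (1 - r_1 - ⋯ - r_{n-1}) x_n` is the power semicircle distribution with
`λ = (n-1)/2`. -/
theorem rwa_arcsin_eq_powerSemicircle (n : ℕ) (hn : 2 ≤ n) :
    Measure.map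
      (fun q : (Fin (n - 1) → ℝ) × (Fin n → ℝ) =>
        (∑ j : Fin (n - 1), q.1 j * q.2 (Fin.castLE (Nat.sub_le n 1) j)) +
          (1 - ∑ j, q.1 j) * q.2 ⟨n - 1, by omega⟩)
      ((dirichletOnes (n - 1)).prod (Measure.pi fun _ : Fin n => arcsinMeasure))
      = powerSemicircle (((n : ℝ) - 1) / 2) := by
  obtain ⟨m, rfl⟩ : ∃ m, n = m + 1 := ⟨n - 1, by omega⟩
  rw [show (((m + 1 : ℕ) : ℝ) - 1) / 2 = m / 2 by push_cast; ring]
  exact map_weighted_average_eq_powerSemicircle m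
end
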